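/- arXiv:1910.08276 — 3 statements merged into one kernel-verified Lean document; each statement's English description precedes it below -/
import Mathlib

section
/- Let 𝒳, 𝒴 be finite sets, p a joint pmf on 𝒳×𝒴, f : 𝒳×𝒴 → ℝ^d, and ε ≥ 0. Then the minimum defining H_{G_ε}(X|Y) is unchanged if the auxiliary variable is restricted to maximal hyperedges: the minimum of I(W;X|Y) over joint pmfs p(w,x,y) = p(x,y)·r(w|x) with r(w|x) = 0 unless x ∈ w and w a hyperedge of G_ε, equals the minimum of the same quantity with r(w|x) supported on maximal hyperedges only. -/
open scoped BigOperators

noncomputable section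

/-- `p` is a joint probability mass function on `X × Y`. -/
def IsJointPMF {X Y : Type*} [Fintype X] [Fintype Y] (p : X → Y → ℝ) : Prop :=
  (∀ x y, 0 ≤ p x y) ∧ ∑ x, ∑ y, p x y = 1

/-- `r` is a conditional pmf `r(w|x)`. -/
def IsCondPMF {X U : Type*} [Fintype U] (r : X → U → ℝ) : Prop :=
  ∀ x, (∀ u, 0 ≤ r x u) ∧ ∑ u, r x u = 1

/-- `S` is a hyperedge of the ε-characteristic hypergraph `G_ε`. -/
def IsHyperedge {X Y E : Type*} [NormedAddCommGroup E]
    (p : X → Y → ℝ) (f : X → Y → E) (ε : ℝ) (S : Finset X) : Prop :=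
  S.Nonempty ∧ ∀ y : Y, ∃ z : E, ∀ x ∈ S, 0 < p x y → ‖f x y - z‖ ≤ ε

/-- A maximal hyperedge of `G_ε`. -/
def IsMaximalHyperedge {X Y E : Type*} [NormedAddCommGroup E]
    (p : X → Y → ℝ) (f : X → Y → E) (ε : ℝ) (S : Finset X) : Prop :=
  IsHyperedge p f ε S ∧ ∀ T : Finset X, IsHyperedge p f ε T → ¬ S ⊂ T

/-- Conditional mutual information `I(W;X|Y)` (in bits). -/
noncomputable def condMI {W X Y : Type*} [Fintype W] [Fintype X] [Fintype Y]
    (q : W → X → Y → ℝ) : ℝ :=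
  ∑ w, ∑ x, ∑ y, q w x y *
    Real.logb 2 ((q w x y * (∑ w', ∑ x', q w' x' y)) /
      ((∑ x', q w x' y) * (∑ w', q w' x y)))

/-- The log-sum inequality. -/
theorem sum_mul_logb_div_le {ι : Type*} (s : Finset ι) (a b : ι → ℝ)
    (ha : ∀ i ∈ s, 0 ≤ a i) (hb : ∀ i ∈ s, 0 ≤ b i) (hab : ∀ i ∈ s, 0 < a i → 0 < b i) :
    (∑ i ∈ s, a i) * Real.logb 2 ((∑ i ∈ s, a i) / ∑ i ∈ s, b i) ≤
      ∑ i ∈ s, a i * Real.logb 2 (a i / b i) := by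
  set A := ∑ i ∈ s, a i with hA
  set B := ∑ i ∈ s, b i with hB
  have hlog : A * Real.log (A / B) ≤ ∑ i ∈ s, a i * Real.log (a i / b i) := by
    rcases (Finset.sum_nonneg ha).eq_or_lt with h0 | hApos
    · have hz : ∀ i ∈ s, a i = 0 := (Finset.sum_eq_zero_iff_of_nonneg ha).1 h0.symm
      rw [Finset.sum_eq_zero fun i hi => by rw [hz i hi, zero_mul], hA, ← h0, zero_mul]
    · have hBpos : 0 < B := by
        obtain ⟨i, hi, hai⟩ := Finset.exists_lt_of_sum_lt
          (show ∑ i ∈ s, (0 : ℝ) < ∑ i ∈ s, a i by simpa only [Finset.sum_const_zero] using hApos)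
        exact Finset.sum_pos' hb ⟨i, hi, hab i hi hai⟩
      have key : ∀ i ∈ s,
          a i * Real.log (A / B) + (a i - b i * (A / B)) ≤ a i * Real.log (a i / b i) := by
        intro i hi
        rcases (ha i hi).eq_or_lt with h | h
        · rw [← h]
          have := mul_nonneg (hb i hi) (div_pos hApos hBpos).le
          simpa using this
        · have hbi := hab i hi h
          have ht : 0 < (A / B) / (a i / b i) := by positivity
          have h1 := mul_le_mul_of_nonneg_left (Real.log_le_sub_one_of_pos ht) h.le
          rw [Real.log_div (by positivity) (by positivity)] at h1
          have h2 : a i * ((A / B) / (a i / b i) - 1) = b i * (A / B) - a i := by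
            field_simp
          linarith
      have hsum := Finset.sum_le_sum key
      rw [Finset.sum_add_distrib, Finset.sum_sub_distrib, ← Finset.sum_mul, ← Finset.sum_mul,
        ← hA, ← hB, mul_div_cancel₀ A hBpos.ne'] at hsum
      linarith
  simp only [Real.logb, ← mul_div_assoc, ← Finset.sum_div]
  exact div_le_div_of_nonneg_right hlog (Real.log_nonneg (by norm_num))

/-- Data processing: `I(g(W);X|Y) ≤ I(W;X|Y)`. -/
theorem condMI_map_le {W V X Y : Type*} [Fintype W] [Fintype V] [DecidableEq V] [Fintype X]
    [Fintype Y] (g : W → V) (q : W → X → Y → ℝ) (hq : ∀ w x y, 0 ≤ q w x y) :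
    condMI (fun v x y => ∑ w with g w = v, q w x y) ≤ condMI q := by
  have hW : ∀ x y, ∑ v, ∑ w with g w = v, q w x y = ∑ w, q w x y := fun x y =>
    Finset.sum_fiberwise _ _ _
  have hX : ∀ v y, ∑ x, ∑ w with g w = v, q w x y = ∑ w with g w = v, ∑ x, q w x y :=
    fun v y => Finset.sum_comm
  have hWX : ∀ y, ∑ v, ∑ w with g w = v, ∑ x, q w x y = ∑ w, ∑ x, q w x y := fun y =>
    Finset.sum_fiberwise _ _ _
  unfold condMI
  simp only [hW, hX, hWX]
  rw [← Finset.sum_fiberwise Finset.univ g]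
  refine Finset.sum_le_sum fun v _ => ?_
  refine (Finset.sum_le_sum fun x _ => ?_).trans_eq Finset.sum_comm
  refine (Finset.sum_le_sum fun y _ => ?_).trans_eq Finset.sum_comm
  have h := sum_mul_logb_div_le (Finset.univ.filter fun w => g w = v) (fun w => q w x y)
    (fun w => (∑ x', q w x' y) * (∑ w', q w' x y) / ∑ w', ∑ x', q w' x' y)
    (fun w _ => hq w x y)
    (fun w _ => div_nonneg (mul_nonneg (Finset.sum_nonneg fun x' _ => hq w x' y)
      (Finset.sum_nonneg fun w' _ => hq w' x y))
      (Finset.sum_nonneg fun w' _ => Finset.sum_nonneg fun x' _ => hq w' x' y))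
    (fun w _ hpos => by
      have hw : 0 < ∑ x', q w x' y :=
        Finset.sum_pos' (fun x' _ => hq w x' y) ⟨x, Finset.mem_univ x, hpos⟩
      have hx : 0 < ∑ w', q w' x y :=
        Finset.sum_pos' (fun w' _ => hq w' x y) ⟨w, Finset.mem_univ w, hpos⟩
      have hy : 0 < ∑ w', ∑ x', q w' x' y :=
        Finset.sum_pos' (fun w' _ => Finset.sum_nonneg fun x' _ => hq w' x' y)
          ⟨w, Finset.mem_univ w, hw⟩
      positivity)
  simpa only [← Finset.sum_div, ← Finset.sum_mul, div_div_eq_mul_div] using h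

/-- Conditional mutual information is nonnegative. -/
theorem condMI_nonneg {W X Y : Type*} [Fintype W] [Fintype X] [Fintype Y]
    (q : W → X → Y → ℝ) (hq : ∀ w x y, 0 ≤ q w x y) : 0 ≤ condMI q := by
  refine le_trans (le_of_eq ?_) (condMI_map_le (fun _ => ()) q hq)
  refine (Finset.sum_eq_zero fun v _ => Finset.sum_eq_zero fun x _ =>
    Finset.sum_eq_zero fun y _ => ?_).symm
  simp only [Finset.univ_unique, Finset.sum_singleton, Finset.filter_true]
  rw [mul_comm (∑ w, q w x y) (∑ x', ∑ w, q w x' y)]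
  rcases eq_or_ne ((∑ x', ∑ w, q w x' y) * ∑ w, q w x y) 0 with h | h
  · rw [h, div_zero, Real.logb_zero, mul_zero]
  · rw [div_self h, Real.logb_one, mul_zero]

theorem isHyperedge_singleton {X Y E : Type*} [NormedAddCommGroup E]
    (p : X → Y → ℝ) (f : X → Y → E) {ε : ℝ} (hε : 0 ≤ ε) (x : X) :
    IsHyperedge p f ε {x} :=
  ⟨Finset.singleton_nonempty x, fun y => ⟨f x y, fun x' hx' _ => by
    rw [Finset.mem_singleton.1 hx', sub_self, norm_zero]; exact hε⟩⟩

theorem IsHyperedge.exists_isMaximalHyperedge {X Y E : Type*} [Finite X] [NormedAddCommGroup E]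
    {p : X → Y → ℝ} {f : X → Y → E} {ε : ℝ} {S : Finset X} (hS : IsHyperedge p f ε S) :
    ∃ T, S ⊆ T ∧ IsMaximalHyperedge p f ε T := by
  obtain ⟨T, hST, hT⟩ :=
    (Set.toFinite {T : Finset X | IsHyperedge p f ε T}).exists_le_maximal hS
  exact ⟨T, hST, hT.prop, fun U hU hTU => hT.not_gt hU hTU⟩

/-- Pushing `W` forward along a choice of maximal hyperedges does not increase `I(W;X|Y)`. -/
theorem exists_isMaximalHyperedge_condMI_le {X Y E : Type*} [Fintype X] [Fintype Y]
    [NormedAddCommGroup E] {p : X → Y → ℝ} {f : X → Y → E} {ε : ℝ} (hp : ∀ x y, 0 ≤ p x y)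
    {r : X → Finset X → ℝ} (hr : IsCondPMF r)
    (hrs : ∀ x w, 0 < r x w → x ∈ w ∧ IsHyperedge p f ε w) :
    ∃ r' : X → Finset X → ℝ, IsCondPMF r' ∧
      (∀ x w, 0 < r' x w → x ∈ w ∧ IsMaximalHyperedge p f ε w) ∧
      condMI (fun w x y => p x y * r' x w) ≤ condMI (fun w x y => p x y * r x w) := by
  classical
  have hex : ∀ w : Finset X, ∃ T, IsHyperedge p f ε w → w ⊆ T ∧ IsMaximalHyperedge p f ε T := by
    intro w
    by_cases hw : IsHyperedge p f ε w
    · obtain ⟨T, hT⟩ := hw.exists_isMaximalHyperedge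
      exact ⟨T, fun _ => hT⟩
    · exact ⟨w, fun h => absurd h hw⟩
  choose g hg using hex
  refine ⟨fun x v => ∑ w with g w = v, r x w, fun x => ⟨fun v =>
    Finset.sum_nonneg fun w _ => (hr x).1 w, ?_⟩, fun x v hv => ?_, ?_⟩
  · rw [Finset.sum_fiberwise]
    exact (hr x).2
  · obtain ⟨w, hw, hpos⟩ := Finset.exists_lt_of_sum_lt
      (show ∑ w with g w = v, (0 : ℝ) < ∑ w with g w = v, r x w by simpa using hv)
    obtain rfl := (Finset.mem_filter.1 hw).2
    obtain ⟨hx, hedge⟩ := hrs x w hpos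
    exact ⟨(hg w hedge).1 hx, (hg w hedge).2⟩
  · simp only [Finset.mul_sum]
    exact condMI_map_le g (fun w x y => p x y * r x w)
      fun w x y => mul_nonneg (hp x y) ((hr x).1 w)

/-- The minimum defining `H_{G_ε}(X|Y)` is unchanged when the auxiliary variable `W`
is restricted to maximal hyperedges of `G_ε`. -/
theorem stmt_5 {X Y : Type*} [Fintype X] [Fintype Y] [DecidableEq X] {d : ℕ}
    (p : X → Y → ℝ) (f : X → Y → EuclideanSpace ℝ (Fin d)) (ε : ℝ)
    (hp : IsJointPMF p) (hε : 0 ≤ ε) :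
    sInf {i : ℝ | ∃ r : X → Finset X → ℝ, IsCondPMF r ∧
        (∀ x w, 0 < r x w → x ∈ w ∧ IsHyperedge p f ε w) ∧
        i = condMI (fun w x y => p x y * r x w)} =
    sInf {i : ℝ | ∃ r : X → Finset X → ℝ, IsCondPMF r ∧
        (∀ x w, 0 < r x w → x ∈ w ∧ IsMaximalHyperedge p f ε w) ∧
        i = condMI (fun w x y => p x y * r x w)} := by
  have bdd : ∀ P : X → Finset X → Prop, BddBelow {i : ℝ | ∃ r : X → Finset X → ℝ,
      IsCondPMF r ∧ (∀ x w, 0 < r x w → P x w) ∧ i = condMI (fun w x y => p x y * r x w)} := by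
    rintro P
    refine ⟨0, ?_⟩
    rintro _ ⟨r, hr, -, rfl⟩
    exact condMI_nonneg _ fun w x y => mul_nonneg (hp.1 x y) ((hr x).1 w)
  have hr₀ : IsCondPMF fun (x : X) (w : Finset X) => if w = {x} then (1 : ℝ) else 0 :=
    fun x => ⟨fun w => by positivity, by simp⟩
  have hs₀ : ∀ (x : X) (w : Finset X), 0 < (if w = {x} then (1 : ℝ) else 0) →
      x ∈ w ∧ IsHyperedge p f ε w := by
    intro x w h
    split_ifs at h with hw
    · exact hw ▸ ⟨Finset.mem_singleton_self x, isHyperedge_singleton p f hε x⟩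
    · exact absurd h (lt_irrefl _)
  apply le_antisymm
  · obtain ⟨r, hr, hrs, -⟩ := exists_isMaximalHyperedge_condMI_le hp.1 hr₀ hs₀
    refine csInf_le_csInf (bdd _) ⟨_, r, hr, hrs, rfl⟩ ?_
    rintro i ⟨r, hr, hrs, hi⟩
    exact ⟨r, hr, fun x w h => ⟨(hrs x w h).1, (hrs x w h).2.1⟩, hi⟩
  · refine le_csInf ⟨_, _, hr₀, hs₀, rfl⟩ ?_
    rintro _ ⟨r, hr, hrs, rfl⟩
    obtain ⟨r', hr', hrs', hle⟩ := exists_isMaximalHyperedge_condMI_le hp.1 hr hrs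
    exact csInf_le_of_le (bdd _) ⟨r', hr', hrs', rfl⟩ hle
end
end

section
/- Let 𝒳 be a finite set, p a pmf on 𝒳, f, g : 𝒳 → ℝ^d with ‖f(x) − g(x)‖ ≤ δ for all x ∈ 𝒳, and ε > 2δ ≥ 0. Then every hyperedge of the (ε − 2δ)-characteristic hypergraph of X with respect to g is a hyperedge of the ε-characteristic hypergraph of X with respect to f, and consequently H_{G_{f,ε}}(X) ≤ H_{G_{g,ε−2δ}}(X). -/
open scoped BigOperators

noncomputable section

/-- `S` is a hyperedge of the ε-characteristic hypergraph (no side information). -/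
def IsHyperedgeNS {X E : Type*} [NormedAddCommGroup E]
    (p : X → ℝ) (h : X → E) (ε : ℝ) (S : Finset X) : Prop :=
  S.Nonempty ∧ ∃ z : E, ∀ x ∈ S, 0 < p x → ‖h x - z‖ ≤ ε

/-- Mutual information `I(W;X)` of a joint pmf `q` on `W × X` (in bits). -/
noncomputable def mutInf {W X : Type*} [Fintype W] [Fintype X] (q : W → X → ℝ) : ℝ :=
  ∑ w, ∑ x, q w x * Real.logb 2 (q w x / ((∑ x', q w x') * (∑ w', q w' x)))

/-- The functional ε-entropy `H_{G_{h,ε}}(X)` (no side information). -/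
noncomputable def funcEntropyNS {X E : Type*} [Fintype X] [DecidableEq X]
    [NormedAddCommGroup E] (p : X → ℝ) (h : X → E) (ε : ℝ) : ℝ :=
  sInf {i : ℝ | ∃ r : X → Finset X → ℝ, IsCondPMF r ∧
    (∀ x w, 0 < r x w → x ∈ w ∧ IsHyperedgeNS p h ε w) ∧
    i = mutInf (fun w x => p x * r x w)}

/-- Gibbs' inequality: the mutual information of a joint pmf is nonnegative. -/
theorem mutInf_nonneg {W X : Type*} [Fintype W] [Fintype X] (q : W → X → ℝ)
    (hq : ∀ w x, 0 ≤ q w x) (hsum : ∑ w, ∑ x, q w x = 1) : 0 ≤ mutInf q := by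
  have hterm : ∀ w x,
      (q w x - (∑ x', q w x') * (∑ w', q w' x)) / Real.log 2 ≤
        q w x * Real.logb 2 (q w x / ((∑ x', q w x') * (∑ w', q w' x))) := by
    intro w x
    have ha : q w x ≤ ∑ x', q w x' :=
      Finset.single_le_sum (f := fun x' => q w x') (fun i _ => hq w i) (Finset.mem_univ x)
    have hb : q w x ≤ ∑ w', q w' x :=
      Finset.single_le_sum (f := fun w' => q w' x) (fun i _ => hq i x) (Finset.mem_univ w)
    generalize (∑ x', q w x') = a at *
    generalize (∑ w', q w' x) = b at *
    rw [Real.logb, ← mul_div_assoc]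
    refine div_le_div_of_nonneg_right ?_ (Real.log_pos one_lt_two).le
    rcases (hq w x).eq_or_lt with h0 | h0
    · rw [← h0] at ha hb ⊢
      simpa using mul_nonneg ha hb
    · have hab : 0 < a * b := mul_pos (h0.trans_le ha) (h0.trans_le hb)
      have hlog := Real.one_sub_inv_le_log_of_pos (div_pos h0 hab)
      calc q w x - a * b = q w x * (1 - (q w x / (a * b))⁻¹) := by
            rw [inv_div]
            field_simp
        _ ≤ _ := mul_le_mul_of_nonneg_left hlog h0.le
  have hzero : ∑ w, ∑ x, (q w x - (∑ x', q w x') * (∑ w', q w' x)) / Real.log 2 = 0 := by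
    have hsum' : ∑ x, ∑ w, q w x = 1 := by rw [Finset.sum_comm, hsum]
    simp_rw [← Finset.sum_div, Finset.sum_sub_distrib, ← Finset.mul_sum, ← Finset.sum_mul]
    simp [hsum, hsum']
  rw [← hzero]
  exact Finset.sum_le_sum fun w _ => Finset.sum_le_sum fun x _ => hterm w x

theorem mutInf_mul_condPMF_nonneg {X U : Type*} [Fintype X] [Fintype U] {p : X → ℝ}
    (hp : (∀ x, 0 ≤ p x) ∧ ∑ x, p x = 1) {r : X → U → ℝ} (hr : IsCondPMF r) :
    0 ≤ mutInf (fun u x => p x * r x u) := by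
  refine mutInf_nonneg _ (fun u x => mul_nonneg (hp.1 x) ((hr x).1 u)) ?_
  rw [Finset.sum_comm]
  simp_rw [← Finset.mul_sum, (hr _).2, mul_one, hp.2]

/-- Enlarging the set of hyperedges can only decrease the functional entropy. -/
theorem funcEntropyNS_le_of_hyperedge_imp {X E F : Type*} [Fintype X] [DecidableEq X]
    [NormedAddCommGroup E] [NormedAddCommGroup F] {p : X → ℝ}
    (hp : (∀ x, 0 ≤ p x) ∧ ∑ x, p x = 1) {f : X → E} {g : X → F} {ε η : ℝ} (hη : 0 ≤ η)
    (hsub : ∀ S : Finset X, IsHyperedgeNS p g η S → IsHyperedgeNS p f ε S) :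
    funcEntropyNS p f ε ≤ funcEntropyNS p g η := by
  refine csInf_le_csInf ⟨0, ?_⟩ ?_ ?_
  · rintro i ⟨r, hr, -, rfl⟩
    exact mutInf_mul_condPMF_nonneg hp hr
  · refine ⟨_, fun x w => if w = {x} then 1 else 0, fun x => ⟨fun u => ?_, by simp⟩, ?_, rfl⟩
    · positivity
    · intro x w hw
      obtain rfl : w = {x} := by
        by_contra h
        simp [h] at hw
      refine ⟨Finset.mem_singleton_self x, Finset.singleton_nonempty x, g x, ?_⟩
      intro y hy _
      rw [Finset.mem_singleton.1 hy]
      simpa using hη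
  · rintro i ⟨r, hr, hw, rfl⟩
    exact ⟨r, hr, fun x w h => ⟨(hw x w h).1, hsub w (hw x w h).2⟩, rfl⟩

/-- **Corollary (δ-approximation)**: if `g` is a `δ`-approximation of `f` and
`ε > 2δ ≥ 0`, every hyperedge of the `(ε−2δ)`-characteristic hypergraph w.r.t. `g`
is a hyperedge of the `ε`-characteristic hypergraph w.r.t. `f`, and consequently
`H_{G_{f,ε}}(X) ≤ H_{G_{g,ε−2δ}}(X)`. -/
theorem stmt_10 {X : Type*} [Fintype X] [DecidableEq X] {d : ℕ}
    (p : X → ℝ) (hp : (∀ x, 0 ≤ p x) ∧ ∑ x, p x = 1)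
    (f g : X → EuclideanSpace ℝ (Fin d)) (δ ε : ℝ)
    (hδ0 : 0 ≤ δ) (hε : 2 * δ < ε)
    (happrox : ∀ x : X, ‖f x - g x‖ ≤ δ) :
    (∀ S : Finset X, IsHyperedgeNS p g (ε - 2 * δ) S → IsHyperedgeNS p f ε S) ∧
    funcEntropyNS p f ε ≤ funcEntropyNS p g (ε - 2 * δ) := by
  have hsub : ∀ S : Finset X, IsHyperedgeNS p g (ε - 2 * δ) S → IsHyperedgeNS p f ε S := by
    rintro S ⟨hS, z, hz⟩
    refine ⟨hS, z, fun x hx hpx => ?_⟩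
    have htri := norm_sub_le_norm_sub_add_norm_sub (f x) (g x) z
    linarith [happrox x, hz x hx hpx]
  exact ⟨hsub, funcEntropyNS_le_of_hyperedge_imp hp (by linarith) hsub⟩
end
end

section
/- Let 𝒳 = {1,2,3}, X uniform on 𝒳, f : 𝒳 → ℝ² given by f(1) = (1,1), f(2) = (2,2.5), f(3) = (3,1), and ε ≥ 13/12. Then the whole set 𝒳 = {1,2,3} is a hyperedge of the ε-characteristic hypergraph G_ε, and H_{G_ε}(X) = 0. Combined with H_{G_ε}(X) = log₂ 3 − 1 for 1 ≤ ε < 13/12, this shows ε ↦ H_{G_ε}(X) is discontinuous at ε = 13/12. -/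
open scoped BigOperators

noncomputable section

/-- The point `(a, b) ∈ ℝ²` with the Euclidean norm. -/
noncomputable def vec2 (a b : ℝ) : EuclideanSpace ℝ (Fin 2) :=
  (WithLp.equiv 2 (Fin 2 → ℝ)).symm ![a, b]

/-- The function of Example 3: `f(1) = (1,1)`, `f(2) = (2,2.5)`, `f(3) = (3,1)`,
with `𝒳 = {1,2,3}` encoded as `Fin 3` (vertex `i` standing for `i+1`). -/
noncomputable def fEx3 : Fin 3 → EuclideanSpace ℝ (Fin 2) :=
  ![vec2 1 1, vec2 2 2.5, vec2 3 1]

/-- The uniform pmf on `𝒳 = {1,2,3}`. -/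
noncomputable def pEx3 (_ : Fin 3) : ℝ := 1 / 3

/-- Membership of a point of the plane in a closed ball, in coordinates. -/
lemma norm_vec2_sub_le_iff {a b ε : ℝ} (hε : 0 ≤ ε) (z : EuclideanSpace ℝ (Fin 2)) :
    ‖vec2 a b - z‖ ≤ ε ↔ (a - z 0) ^ 2 + (b - z 1) ^ 2 ≤ ε ^ 2 := by
  rw [EuclideanSpace.norm_eq, Real.sqrt_le_left hε]
  simp [vec2, Fin.sum_univ_two]

/-- The relative-entropy bound for nonnegative weights supported on at most `k` points: compared
with a constant `c`, they gain at least `log₂ (1 / (k c))` per unit of mass. -/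
lemma sum_mul_logb_ge_of_card_le {X : Type*} [Fintype X] {a : X → ℝ} (ha : ∀ x, 0 ≤ a x)
    {S : Finset X} (hS : ∀ x, 0 < a x → x ∈ S) {k : ℕ} (hk : 0 < k) (hSk : S.card ≤ k)
    {c : ℝ} (hc : 0 < c) :
    (∑ x, a x) * Real.logb 2 (1 / (k * c)) ≤
      ∑ x, a x * Real.logb 2 (a x / ((∑ x', a x') * c)) := by
  set s := ∑ x, a x with hs
  have hk' : (0 : ℝ) < k := by exact_mod_cast hk
  have hs0 : 0 ≤ s := Finset.sum_nonneg fun x _ => ha x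
  have hout : ∀ x ∉ S, a x = 0 := fun x hx =>
    le_antisymm (not_lt.1 fun h => hx (hS x h)) (ha x)
  have hsS : ∑ x ∈ S, a x = s :=
    Finset.sum_subset (Finset.subset_univ S) fun x _ hx => hout x hx
  have hterm : ∀ x, a x * Real.log (1 / (k * c)) + (a x - s / k) ≤
      a x * Real.log (a x / (s * c)) := by
    intro x
    rcases (ha x).eq_or_lt with h | h
    · simp only [← h, zero_mul, zero_add, zero_sub]
      exact neg_nonpos.2 (by positivity)
    · have hspos : 0 < s := h.trans_le (Finset.single_le_sum (fun y _ => ha y) (Finset.mem_univ x))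
      have hsplit : a x / (s * c) = 1 / (k * c) * (k * a x / s) := by field_simp
      have hlog := Real.one_sub_inv_le_log_of_pos (show 0 < k * a x / s by positivity)
      have hmul := mul_le_mul_of_nonneg_left hlog h.le
      have hexp : a x * (1 - (k * a x / s)⁻¹) = a x - s / k := by field_simp
      rw [hsplit, Real.log_mul (by positivity) (by positivity), mul_add]
      linarith
  have hsum : s * Real.log (1 / (k * c)) ≤ ∑ x, a x * Real.log (a x / (s * c)) := by
    have hle := Finset.sum_le_sum fun x (_ : x ∈ S) => hterm x
    rw [Finset.sum_add_distrib, ← Finset.sum_mul, Finset.sum_sub_distrib, hsS, Finset.sum_const,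
      nsmul_eq_mul] at hle
    have hcard : (S.card : ℝ) * (s / k) ≤ s := by
      calc (S.card : ℝ) * (s / k) ≤ k * (s / k) := by gcongr
        _ = s := by field_simp
    rw [← Finset.sum_subset (Finset.subset_univ S) fun x _ hx => by simp [hout x hx]]
    linarith
  have hlog2 : 0 < Real.log 2 := Real.log_pos one_lt_two
  simp only [Real.logb, mul_div_assoc', ← Finset.sum_div]
  gcongr

/-- If every admissible set has at most `k` elements, then `I(W;X) ≥ log₂ (|𝒳| / k)`
for uniform `X`. -/
lemma logb_le_mutInf_of_card_le {X : Type*} [Fintype X] [Nonempty X]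
    {r : X → Finset X → ℝ} (hr : IsCondPMF r) {k : ℕ} (hk : 0 < k)
    (hmem : ∀ x w, 0 < r x w → x ∈ w) (hcard : ∀ x w, 0 < r x w → w.card ≤ k) :
    Real.logb 2 (Fintype.card X / k) ≤
      mutInf (fun w x => 1 / (Fintype.card X : ℝ) * r x w) := by
  have hN : (0 : ℝ) < Fintype.card X := by exact_mod_cast Fintype.card_pos
  have hpos : ∀ x w, 0 < 1 / (Fintype.card X : ℝ) * r x w → 0 < r x w := fun x w h =>
    pos_of_mul_pos_right h (by positivity)
  have hX : ∀ x, ∑ w, 1 / (Fintype.card X : ℝ) * r x w = 1 / (Fintype.card X : ℝ) := fun x => by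
    rw [← Finset.mul_sum, (hr x).2, mul_one]
  have htotal : ∑ w, ∑ x, 1 / (Fintype.card X : ℝ) * r x w = 1 := by
    rw [Finset.sum_comm]
    simp only [hX]
    simp
  have hconst : (Fintype.card X : ℝ) / k = 1 / (k * (1 / (Fintype.card X : ℝ))) := by
    field_simp
  have hmass := congrArg (· * Real.logb 2 (Fintype.card X / k)) htotal
  rw [one_mul, Finset.sum_mul] at hmass
  rw [mutInf, ← hmass, hconst]
  simp only [hX]
  refine Finset.sum_le_sum fun w _ => ?_
  have hnonneg : ∀ x, 0 ≤ 1 / (Fintype.card X : ℝ) * r x w := fun x =>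
    mul_nonneg (by positivity) ((hr x).1 w)
  by_cases hw : ∃ x, 0 < r x w
  · obtain ⟨x, hx⟩ := hw
    exact sum_mul_logb_ge_of_card_le hnonneg (fun y hy => hmem y w (hpos y w hy)) hk
      (hcard x w hx) (by positivity)
  · push Not at hw
    exact sum_mul_logb_ge_of_card_le hnonneg (S := ∅)
      (fun y hy => absurd (hpos y w hy) (hw y).not_gt) hk (by simp) (by positivity)

/-- If `X` is uniform and, given `W = w`, uniform on a set of `k` elements, then
`I(W;X) = log₂ (|𝒳| / k)`. -/
lemma mutInf_eq_logb {X W : Type*} [Fintype X] [Nonempty X] [Fintype W]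
    {r : X → W → ℝ} (hr : IsCondPMF r) {k : ℕ}
    (hunif : ∀ x w, r x w ≠ 0 → ∑ x', r x' w = k * r x w) :
    mutInf (fun w x => 1 / (Fintype.card X : ℝ) * r x w) =
      Real.logb 2 (Fintype.card X / k) := by
  have hN : (0 : ℝ) < Fintype.card X := by exact_mod_cast Fintype.card_pos
  have hX : ∀ x, ∑ w, 1 / (Fintype.card X : ℝ) * r x w = 1 / (Fintype.card X : ℝ) := fun x => by
    rw [← Finset.mul_sum, (hr x).2, mul_one]
  have hterm : ∀ w x, 1 / (Fintype.card X : ℝ) * r x w * Real.logb 2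
      (1 / (Fintype.card X : ℝ) * r x w /
        ((∑ x', 1 / (Fintype.card X : ℝ) * r x' w) * (1 / (Fintype.card X : ℝ)))) =
      1 / (Fintype.card X : ℝ) * r x w * Real.logb 2 (Fintype.card X / k) := by
    intro w x
    by_cases h : r x w = 0
    · simp [h]
    · congr 2
      rw [← Finset.mul_sum, hunif x w h]
      field_simp
  simp only [mutInf, hX, hterm]
  rw [Finset.sum_comm]
  simp only [← Finset.sum_mul, hX]
  simp

/-- On three equiprobable points, if the largest hyperedges have `k` elements and all `k`-element
sets are hyperedges, then the functional entropy is `log₂ (3 / k)`. -/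
lemma funcEntropyNS_pEx3_eq {E : Type*} [NormedAddCommGroup E] {f : Fin 3 → E} {ε : ℝ} {k : ℕ}
    (hk : 0 < k) (hk3 : k ≤ 3) (hle : ∀ w, IsHyperedgeNS pEx3 f ε w → w.card ≤ k)
    (hall : ∀ w : Finset (Fin 3), w.card = k → IsHyperedgeNS pEx3 f ε w) :
    funcEntropyNS pEx3 f ε = Real.logb 2 (3 / k) := by
  have hp : ∀ x, pEx3 x = 1 / (Fintype.card (Fin 3) : ℝ) := fun x => by simp [pEx3]
  have h3 : (3 : ℝ) = (Fintype.card (Fin 3) : ℝ) := by simp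
  have hchoose : (0 : ℝ) < Nat.choose 2 (k - 1) := by
    exact_mod_cast Nat.choose_pos (by lia)
  refine IsLeast.csInf_eq ⟨?_, ?_⟩
  · let r : Fin 3 → Finset (Fin 3) → ℝ := fun x w =>
      if x ∈ w ∧ w.card = k then 1 / (Nat.choose 2 (k - 1) : ℝ) else 0
    have hr : IsCondPMF r := by
      intro x
      refine ⟨fun w => ?_, ?_⟩
      · dsimp only [r]
        split_ifs <;> positivity
      · have hcount : (Finset.univ.filter fun w : Finset (Fin 3) => x ∈ w ∧ w.card = k).card =
            Nat.choose 2 (k - 1) := by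
          interval_cases k <;> revert x <;> decide
        dsimp only [r]
        rw [← Finset.sum_filter, Finset.sum_const, hcount, nsmul_eq_mul]
        field_simp
    have hsupp : ∀ x w, r x w ≠ 0 → x ∈ w ∧ w.card = k := fun x w h => by
      by_contra hn
      exact h (if_neg hn)
    refine ⟨r, hr, fun x w h => ?_, ?_⟩
    · obtain ⟨hx, hw⟩ := hsupp x w h.ne'
      exact ⟨hx, hall w hw⟩
    · simp only [hp]
      rw [h3]
      refine (mutInf_eq_logb hr fun x w h => ?_).symm
      obtain ⟨hx, hw⟩ := hsupp x w h
      simp [r, hx, hw]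
  · rintro i ⟨r, hr, hsupp, rfl⟩
    simp only [hp]
    rw [h3]
    exact logb_le_mutInf_of_card_le hr hk (fun x w h => (hsupp x w h).1)
      fun x w h => hle w (hsupp x w h).2

/-- The three points lie on the circle of radius `13 / 12` around `(2, 17 / 12)`. -/
lemma isHyperedgeNS_fEx3_univ {ε : ℝ} (hε : 13 / 12 ≤ ε) :
    IsHyperedgeNS pEx3 fEx3 ε Finset.univ := by
  refine ⟨Finset.univ_nonempty, vec2 2 (17 / 12), fun x _ _ => ?_⟩
  fin_cases x <;>
  · refine (norm_vec2_sub_le_iff (by linarith) _).2 ?_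
    simp only [vec2, WithLp.equiv_symm_apply, Matrix.cons_val_zero, Matrix.cons_val_one]
    nlinarith

/-- Each pair of points lies in the unit ball around its midpoint. -/
lemma isHyperedgeNS_fEx3_of_card_eq_two {ε : ℝ} (hε : 1 ≤ ε) {w : Finset (Fin 3)}
    (hw : w.card = 2) : IsHyperedgeNS pEx3 fEx3 ε w := by
  refine ⟨Finset.card_pos.1 (by lia), ?_⟩
  have hcases : ∀ w : Finset (Fin 3), w.card = 2 → w = {0, 1} ∨ w = {0, 2} ∨ w = {1, 2} := by
    decide
  rcases hcases w hw with rfl | rfl | rfl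
  on_goal 1 => refine ⟨vec2 1.5 1.75, ?_⟩
  on_goal 2 => refine ⟨vec2 2 1, ?_⟩
  on_goal 3 => refine ⟨vec2 2.5 1.75, ?_⟩
  all_goals
    simp only [Finset.mem_insert, Finset.mem_singleton]
    rintro x (rfl | rfl) -
  all_goals
    refine (norm_vec2_sub_le_iff (by linarith) _).2 ?_
    simp only [vec2, WithLp.equiv_symm_apply, Matrix.cons_val_zero, Matrix.cons_val_one]
    nlinarith

/-- No ball of radius less than `13 / 12` contains all three points. -/
lemma not_isHyperedgeNS_fEx3_univ {ε : ℝ} (hε0 : 0 ≤ ε) (hε : ε < 13 / 12) :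
    ¬ IsHyperedgeNS pEx3 fEx3 ε Finset.univ := by
  rintro ⟨-, z, hz⟩
  have hp : ∀ x, 0 < pEx3 x := fun x => by norm_num [pEx3]
  have h0 := (norm_vec2_sub_le_iff hε0 z).1 (hz 0 (Finset.mem_univ _) (hp 0))
  have h1 := (norm_vec2_sub_le_iff hε0 z).1 (hz 1 (Finset.mem_univ _) (hp 1))
  have h2 := (norm_vec2_sub_le_iff hε0 z).1 (hz 2 (Finset.mem_univ _) (hp 2))
  have hsq : ε ^ 2 < (13 / 12) ^ 2 := by gcongr
  linarith [sq_nonneg (z 0 - 2), sq_nonneg (z 1 - 17 / 12)]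

lemma funcEntropyNS_fEx3_of_ge {ε : ℝ} (hε : 13 / 12 ≤ ε) :
    funcEntropyNS pEx3 fEx3 ε = 0 := by
  rw [funcEntropyNS_pEx3_eq (k := 3) (by norm_num) le_rfl (fun w _ => card_finset_fin_le w)]
  · norm_num
  · intro w hw
    rw [Finset.card_eq_iff_eq_univ w |>.1 (by simpa using hw)]
    exact isHyperedgeNS_fEx3_univ hε

lemma funcEntropyNS_fEx3_of_lt {ε : ℝ} (h1 : 1 ≤ ε) (hε : ε < 13 / 12) :
    funcEntropyNS pEx3 fEx3 ε = Real.logb 2 3 - 1 := by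
  rw [funcEntropyNS_pEx3_eq (k := 2) (by norm_num) (by norm_num) ?_
    fun w hw => isHyperedgeNS_fEx3_of_card_eq_two h1 hw]
  · rw [Nat.cast_ofNat, Real.logb_div (by norm_num) (by norm_num),
      Real.logb_self_eq_one one_lt_two]
  · intro w hw
    by_contra! hcard
    have hw3 : w = Finset.univ :=
      (Finset.card_eq_iff_eq_univ w).1
        (le_antisymm (Finset.card_le_univ w) (by simpa using Nat.succ_le_of_lt hcard))
    exact not_isHyperedgeNS_fEx3_univ (by linarith) hε (hw3 ▸ hw)

/-- **Example 3, regime `ε ≥ 13/12`**: the whole set `𝒳 = {1,2,3}` is a hyperedge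
of `G_ε` and `H_{G_ε}(X) = 0`; combined with `H_{G_ε}(X) = log₂ 3 − 1` for
`1 ≤ ε < 13/12`, the map `ε ↦ H_{G_ε}(X)` is discontinuous at `ε = 13/12`. -/
theorem stmt_17 :
    (∀ ε : ℝ, 13 / 12 ≤ ε →
      IsHyperedgeNS pEx3 fEx3 ε (Finset.univ : Finset (Fin 3)) ∧
      funcEntropyNS pEx3 fEx3 ε = 0) ∧
    (∀ ε : ℝ, 1 ≤ ε → ε < 13 / 12 →
      funcEntropyNS pEx3 fEx3 ε = Real.logb 2 3 - 1) ∧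
    ¬ ContinuousAt (fun ε : ℝ => funcEntropyNS pEx3 fEx3 ε) (13 / 12) := by
  refine ⟨fun ε hε => ⟨isHyperedgeNS_fEx3_univ hε, funcEntropyNS_fEx3_of_ge hε⟩,
    fun ε => funcEntropyNS_fEx3_of_lt, fun hcont => ?_⟩
  have hleft : Filter.Tendsto (fun ε : ℝ => funcEntropyNS pEx3 fEx3 ε)
      (nhdsWithin (13 / 12) (Set.Iio (13 / 12))) (nhds (Real.logb 2 3 - 1)) := by
    refine tendsto_const_nhds.congr' ?_
    filter_upwards [Ico_mem_nhdsLT (show (1 : ℝ) < 13 / 12 by norm_num)] with ε hε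
    exact (funcEntropyNS_fEx3_of_lt hε.1 hε.2).symm
  have hlim := tendsto_nhds_unique hleft (hcont.tendsto.mono_left nhdsWithin_le_nhds)
  rw [funcEntropyNS_fEx3_of_ge le_rfl] at hlim
  have hlog : 1 < Real.logb 2 3 := by
    rw [Real.lt_logb_iff_rpow_lt one_lt_two (by norm_num)]
    norm_num
  linarith
end
end
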